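/- Let V be a complex Banach space, m ∈ ℝ, ρ ∈ ℝ with −1 < ρ ≤ 1, F ∈ S^{m,ρ}(ℝ^{2n}, V), and μ ∈ ℕ^n a multiindex. Write ⟨p,x⟩ = ⟪p, Mx⟫. Then the derivative ∂_p^μ F (in the first n variables) belongs to S^{m−ρ|μ|, ρ}(ℝ^{2n}, V), the functions (p,x) ↦ (Mx)^μ F(p,x) and (p,x) ↦ (M^T p)^μ F(p,x) belong to S^{m+|μ|, ρ}(ℝ^{2n}, V) (where (Mx)^μ := ∏_k ((Mx)_k)^{μ_k} and M^T is the Euclidean transpose of M), and the oscillatory integrals satisfy I(∂_p^μ F) = (−i)^{|μ|} I((Mx)^μ F) and I(∂_x^μ F) = (−i)^{|μ|} I((M^T p)^μ F). -/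

import Mathlib

open Filter MeasureTheory

noncomputable def pder {n : ℕ} {V : Type*} [NormedAddCommGroup V] [NormedSpace ℝ V]
    (i : Fin n) (f : (Fin n → ℝ) → V) : (Fin n → ℝ) → V :=
  fun x => fderiv ℝ f x (Pi.single i 1)

noncomputable def mder {n : ℕ} {V : Type*} [NormedAddCommGroup V] [NormedSpace ℝ V]
    (μ : Fin n → ℕ) (f : (Fin n → ℝ) → V) : (Fin n → ℝ) → V :=
  (List.finRange n).foldr (fun i g => (pder i)^[μ i] g) f

def mOrder {n : ℕ} (μ : Fin n → ℕ) : ℕ := ∑ i, μ i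

noncomputable def symWt {n : ℕ} (m ρ : ℝ) (μ : Fin n → ℕ) (x : Fin n → ℝ) : ℝ :=
  (1 + ‖x‖ ^ 2) ^ (-(m - ρ * (mOrder μ : ℝ)) / 2)

noncomputable def symNorm {n : ℕ} {V : Type*} [NormedAddCommGroup V] [NormedSpace ℝ V]
    (m ρ : ℝ) (μ : Fin n → ℕ) (F : (Fin n → ℝ) → V) : ℝ :=
  ⨆ x : Fin n → ℝ, symWt m ρ μ x * ‖mder μ F x‖

def IsSymbol {n : ℕ} {V : Type*} [NormedAddCommGroup V] [NormedSpace ℝ V]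
    (m ρ : ℝ) (F : (Fin n → ℝ) → V) : Prop :=
  ContDiff ℝ (⊤ : ℕ∞) F ∧ ∀ μ : Fin n → ℕ, ∃ C : ℝ, ∀ x, symWt m ρ μ x * ‖mder μ F x‖ ≤ C
def fstHalf {n : ℕ} (z : Fin (n + n) → ℝ) : Fin n → ℝ := fun i => z (Fin.castAdd n i)

def sndHalf {n : ℕ} (z : Fin (n + n) → ℝ) : Fin n → ℝ := fun i => z (Fin.natAdd n i)

noncomputable def pairM {n : ℕ} (M : Matrix (Fin n) (Fin n) ℝ) (p x : Fin n → ℝ) : ℝ :=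
  ∑ i, p i * M.mulVec x i

noncomputable def phase {n : ℕ} (M : Matrix (Fin n) (Fin n) ℝ) (z : Fin (n + n) → ℝ) : ℂ :=
  Complex.exp (Complex.I * (pairM M (fstHalf z) (sndHalf z) : ℂ))

noncomputable def cutInt {n : ℕ} {V : Type*} [NormedAddCommGroup V] [NormedSpace ℝ V]
    [NormedSpace ℂ V] [IsScalarTower ℝ ℂ V] (M : Matrix (Fin n) (Fin n) ℝ)
    (χ : (Fin (n + n) → ℝ) → ℝ) (z₀ : Fin (n + n) → ℝ) (ε : ℝ)
    (F : (Fin (n + n) → ℝ) → V) : V :=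
  ((2 * Real.pi) ^ n)⁻¹ • ∫ z : Fin (n + n) → ℝ, χ (ε • (z - z₀)) • (phase M z • F z)

def IsOscInt {n : ℕ} {V : Type*} [NormedAddCommGroup V] [NormedSpace ℝ V]
    [NormedSpace ℂ V] [IsScalarTower ℝ ℂ V] (M : Matrix (Fin n) (Fin n) ℝ)
    (F : (Fin (n + n) → ℝ) → V) (v : V) : Prop :=
  ∀ χ : (Fin (n + n) → ℝ) → ℝ, ContDiff ℝ (⊤ : ℕ∞) χ → HasCompactSupport χ →
    (∀ᶠ z in nhds (0 : Fin (n + n) → ℝ), χ z = 1) →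
    ∀ z₀ : Fin (n + n) → ℝ,
      Filter.Tendsto (fun ε : ℝ => cutInt M χ z₀ ε F) (nhdsWithin 0 (Set.Ioi 0)) (nhds v)

open Classical in
noncomputable def oscInt {n : ℕ} {V : Type*} [NormedAddCommGroup V] [NormedSpace ℝ V]
    [NormedSpace ℂ V] [IsScalarTower ℝ ℂ V] (M : Matrix (Fin n) (Fin n) ℝ)
    (F : (Fin (n + n) → ℝ) → V) : V :=
  if h : ∃ v, IsOscInt M F v then h.choose else 0

section PartialDerivatives

variable {d : ℕ} {V : Type*} [NormedAddCommGroup V] [NormedSpace ℝ V]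

theorem contDiff_pder {f : (Fin d → ℝ) → V} (hf : ContDiff ℝ (⊤ : ℕ∞) f) (j : Fin d) :
    ContDiff ℝ (⊤ : ℕ∞) (pder j f) :=
  (hf.fderiv_right (m := (⊤ : ℕ∞)) (by simp)).clm_apply contDiff_const

theorem ContDiff.differentiable_top {f : (Fin d → ℝ) → V} (hf : ContDiff ℝ (⊤ : ℕ∞) f) :
    Differentiable ℝ f :=
  hf.differentiable (by simp)

theorem contDiff_pder_iterate {f : (Fin d → ℝ) → V} (hf : ContDiff ℝ (⊤ : ℕ∞) f) (j : Fin d)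
    (k : ℕ) : ContDiff ℝ (⊤ : ℕ∞) ((pder j)^[k] f) := by
  induction k with
  | zero => exact hf
  | succ k ih => rw [Function.iterate_succ_apply']; exact contDiff_pder ih j

theorem pder_comm {f : (Fin d → ℝ) → V} (hf : ContDiff ℝ (⊤ : ℕ∞) f) (i j : Fin d) :
    pder i (pder j f) = pder j (pder i f) := by
  have h1 : Differentiable ℝ (fderiv ℝ f) :=
    (hf.fderiv_right (m := (⊤ : ℕ∞)) (by simp)).differentiable (by simp)
  have h2 : ∀ (i j : Fin d) (x), pder i (pder j f) x =
      fderiv ℝ (fderiv ℝ f) x (Pi.single i 1) (Pi.single j 1) := by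
    intro i j x
    unfold pder
    rw [fderiv_clm_apply h1.differentiableAt (by fun_prop)]
    simp
  funext x
  rw [h2, h2]
  exact (hf.contDiffAt.isSymmSndFDerivAt
    (by simpa using WithTop.coe_le_coe.2 (le_top (a := (2 : ℕ∞))))) _ _

theorem pder_iterate_comm {f : (Fin d → ℝ) → V} (hf : ContDiff ℝ (⊤ : ℕ∞) f) (i j : Fin d)
    (k : ℕ) : (pder i)^[k] (pder j f) = pder j ((pder i)^[k] f) := by
  induction k with
  | zero => rfl
  | succ k ih =>
    rw [Function.iterate_succ_apply', ih, pder_comm (contDiff_pder_iterate hf i k),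
      Function.iterate_succ_apply']

theorem pder_add {f g : (Fin d → ℝ) → V} (hf : Differentiable ℝ f) (hg : Differentiable ℝ g)
    (j : Fin d) : pder j (fun x => f x + g x) = fun x => pder j f x + pder j g x := by
  funext x
  simp [pder, fderiv_fun_add (hf x) (hg x)]

theorem pder_smul {a : (Fin d → ℝ) → ℝ} {f : (Fin d → ℝ) → V} (ha : Differentiable ℝ a)
    (hf : Differentiable ℝ f) (j : Fin d) :
    pder j (fun x => a x • f x) = fun x => pder j a x • f x + a x • pder j f x := by
  funext x
  simp [pder, fderiv_fun_smul (ha x) (hf x), add_comm]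

theorem pder_const_smul {𝕜 : Type*} [NormedField 𝕜] [NormedSpace 𝕜 V] [SMulCommClass ℝ 𝕜 V]
    {f : (Fin d → ℝ) → V} (hf : Differentiable ℝ f) (c : 𝕜) (j : Fin d) :
    pder j (fun x => c • f x) = fun x => c • pder j f x := by
  funext x
  simp [pder, fderiv_fun_const_smul (hf x) c]

theorem pder_const (c : V) (j : Fin d) : pder j (fun _ => c) = fun _ => 0 := by
  funext x
  simp [pder]

theorem pder_clm (L : (Fin d → ℝ) →L[ℝ] V) (j : Fin d) :
    pder j (fun x => L x) = fun _ => L (Pi.single j 1) := by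
  funext x
  simp [pder]

theorem pder_comp_smul_sub {f : (Fin d → ℝ) → V} (hf : Differentiable ℝ f) (ε : ℝ)
    (z₀ : Fin d → ℝ) (j : Fin d) :
    pder j (fun z => f (ε • (z - z₀))) = fun z => ε • pder j f (ε • (z - z₀)) := by
  funext z
  have h : HasFDerivAt (fun z : Fin d → ℝ => ε • (z - z₀))
      (ε • ContinuousLinearMap.id ℝ (Fin d → ℝ)) z :=
    ((hasFDerivAt_id z).sub_const z₀).const_smul ε
  have h2 := ((hf (ε • (z - z₀))).hasFDerivAt.comp z h).fderiv
  simp only [Function.comp_def] at h2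
  simp [pder, h2]

theorem hasCompactSupport_pder {f : (Fin d → ℝ) → V} (hf : HasCompactSupport f) (j : Fin d) :
    HasCompactSupport (pder j f) :=
  hf.fderiv_apply ℝ _

theorem contDiff_foldr_pder {f : (Fin d → ℝ) → V} (hf : ContDiff ℝ (⊤ : ℕ∞) f)
    (μ : Fin d → ℕ) (l : List (Fin d)) :
    ContDiff ℝ (⊤ : ℕ∞) (l.foldr (fun i g => (pder i)^[μ i] g) f) := by
  induction l with
  | nil => exact hf
  | cons i l ih => exact contDiff_pder_iterate ih i _

theorem foldr_pder_add_single {f : (Fin d → ℝ) → V} (hf : ContDiff ℝ (⊤ : ℕ∞) f)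
    (μ : Fin d → ℕ) (j : Fin d) (l : List (Fin d)) (hl : l.Nodup) :
    l.foldr (fun i g => (pder i)^[(μ + Pi.single j 1 : Fin d → ℕ) i] g) f =
      if j ∈ l then pder j (l.foldr (fun i g => (pder i)^[μ i] g) f)
      else l.foldr (fun i g => (pder i)^[μ i] g) f := by
  induction l with
  | nil => simp
  | cons i l ih =>
    obtain ⟨hi, hl⟩ := List.nodup_cons.1 hl
    rw [List.foldr_cons, List.foldr_cons, ih hl]
    by_cases hij : i = j
    · subst hij
      simp [hi, Function.iterate_succ_apply']
    · have hji : j ≠ i := Ne.symm hij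
      by_cases hj : j ∈ l
      · simp [hj, hij, pder_iterate_comm (contDiff_foldr_pder hf μ l)]
      · simp [hj, hij, hji]

theorem mder_add_single {f : (Fin d → ℝ) → V} (hf : ContDiff ℝ (⊤ : ℕ∞) f)
    (μ : Fin d → ℕ) (j : Fin d) : mder (μ + Pi.single j 1) f = pder j (mder μ f) := by
  simpa [mder] using foldr_pder_add_single hf μ j _ (List.nodup_finRange d)

end PartialDerivatives

section SymbolFamilies

variable {ι : Type*} {d : ℕ} {V : Type*} [NormedAddCommGroup V]

/-- A bound of order `m` on the values, uniform in the parameter. -/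
def GrowthBound (m : ℝ) (u : ι → (Fin d → ℝ) → V) : Prop :=
  ∃ C : ℝ, ∀ i z, ‖u i z‖ ≤ C * (1 + ‖z‖ ^ 2) ^ (m / 2)

variable {ρ m m' : ℝ} {k : ℕ} {u v : ι → (Fin d → ℝ) → V}

theorem one_le_one_add_norm_sq (z : Fin d → ℝ) : 1 ≤ 1 + ‖z‖ ^ 2 := by
  nlinarith [sq_nonneg ‖z‖]

theorem GrowthBound.exists_nonneg (h : GrowthBound m u) :
    ∃ C : ℝ, 0 ≤ C ∧ ∀ i z, ‖u i z‖ ≤ C * (1 + ‖z‖ ^ 2) ^ (m / 2) := by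
  obtain ⟨C, hC⟩ := h
  refine ⟨max C 0, le_max_right _ _, fun i z => (hC i z).trans ?_⟩
  gcongr
  exact le_max_left _ _

theorem GrowthBound.mono (h : GrowthBound m u) (hm : m ≤ m') : GrowthBound m' u := by
  obtain ⟨C, hC0, hC⟩ := h.exists_nonneg
  refine ⟨C, fun i z => (hC i z).trans ?_⟩
  have := one_le_one_add_norm_sq z
  gcongr

theorem GrowthBound.add (h : GrowthBound m u) (h' : GrowthBound m v) :
    GrowthBound m (fun i z => u i z + v i z) := by
  obtain ⟨C, hC⟩ := h
  obtain ⟨C', hC'⟩ := h'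
  exact ⟨C + C', fun i z => (norm_add_le _ _).trans (by linarith [hC i z, hC' i z])⟩

theorem GrowthBound.const_smul {𝕜 : Type*} [NormedField 𝕜] [NormedSpace 𝕜 V]
    (h : GrowthBound m u) (c : 𝕜) : GrowthBound m (fun i z => c • u i z) := by
  obtain ⟨C, hC⟩ := h
  refine ⟨‖c‖ * C, fun i z => ?_⟩
  rw [norm_smul, mul_assoc]
  exact mul_le_mul_of_nonneg_left (hC i z) (norm_nonneg c)

variable [NormedSpace ℝ V]

theorem GrowthBound.smul {a : ι → (Fin d → ℝ) → ℝ} (h : GrowthBound m a)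
    (h' : GrowthBound m' u) : GrowthBound (m + m') (fun i z => a i z • u i z) := by
  obtain ⟨C, hC0, hC⟩ := h.exists_nonneg
  obtain ⟨C', hC'0, hC'⟩ := h'.exists_nonneg
  refine ⟨C * C', fun i z => ?_⟩
  have hz : 0 < 1 + ‖z‖ ^ 2 := by positivity
  rw [norm_smul, add_div, Real.rpow_add hz]
  calc ‖a i z‖ * ‖u i z‖ ≤ (C * (1 + ‖z‖ ^ 2) ^ (m / 2)) * (C' * (1 + ‖z‖ ^ 2) ^ (m' / 2)) := by
        gcongr
        · exact hC i z
        · exact hC' i z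
    _ = _ := by ring

/-- Bounds, uniform in the parameter, of symbol type `(m, ρ)` on all derivatives up to order `k`. -/
def SymBound (ρ : ℝ) : ℕ → ℝ → (ι → (Fin d → ℝ) → V) → Prop
  | 0, m, u => GrowthBound m u
  | k + 1, m, u => GrowthBound m u ∧ ∀ j, SymBound ρ k (m - ρ) (fun i => pder j (u i))

/-- A family of smooth functions which is bounded in the symbol space of order `m` and type `ρ`. -/
structure IsSymFam (ρ m : ℝ) (u : ι → (Fin d → ℝ) → V) : Prop where
  smooth : ∀ i, ContDiff ℝ (⊤ : ℕ∞) (u i)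
  bound : ∀ k, SymBound ρ k m u

theorem SymBound.mono (h : SymBound ρ k m u) (hm : m ≤ m') : SymBound ρ k m' u := by
  induction k generalizing m m' u with
  | zero => exact GrowthBound.mono h hm
  | succ k ih => exact ⟨h.1.mono hm, fun j => ih (h.2 j) (by linarith)⟩

theorem SymBound.pred (h : SymBound ρ (k + 1) m u) : SymBound ρ k m u := by
  induction k generalizing m u with
  | zero => exact h.1
  | succ k ih => exact ⟨h.1, fun j => ih (h.2 j)⟩

theorem SymBound.add (hu : ∀ i, ContDiff ℝ (⊤ : ℕ∞) (u i)) (hv : ∀ i, ContDiff ℝ (⊤ : ℕ∞) (v i))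
    (h : SymBound ρ k m u) (h' : SymBound ρ k m v) :
    SymBound ρ k m (fun i z => u i z + v i z) := by
  induction k generalizing m u v with
  | zero => exact GrowthBound.add h h'
  | succ k ih =>
    refine ⟨h.1.add h'.1, fun j => ?_⟩
    simp only [pder_add (hu _).differentiable_top (hv _).differentiable_top]
    exact ih (fun i => contDiff_pder (hu i) j) (fun i => contDiff_pder (hv i) j) (h.2 j) (h'.2 j)

theorem SymBound.smul {a : ι → (Fin d → ℝ) → ℝ} (ha : ∀ i, ContDiff ℝ (⊤ : ℕ∞) (a i))
    (hu : ∀ i, ContDiff ℝ (⊤ : ℕ∞) (u i)) (h : SymBound ρ k m a) (h' : SymBound ρ k m' u) :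
    SymBound ρ k (m + m') (fun i z => a i z • u i z) := by
  induction k generalizing m m' a u with
  | zero => exact GrowthBound.smul h h'
  | succ k ih =>
    refine ⟨h.1.smul h'.1, fun j => ?_⟩
    simp only [pder_smul (ha _).differentiable_top (hu _).differentiable_top]
    refine SymBound.add (fun i => (contDiff_pder (ha i) j).smul (hu i))
      (fun i => (ha i).smul (contDiff_pder (hu i) j)) ?_ ?_
    · exact (ih (fun i => contDiff_pder (ha i) j) hu (h.2 j) h'.pred).mono (by linarith)
    · exact (ih ha (fun i => contDiff_pder (hu i) j) h.pred (h'.2 j)).mono (by linarith)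

namespace IsSymFam

theorem mono (h : IsSymFam ρ m u) (hm : m ≤ m') : IsSymFam ρ m' u :=
  ⟨h.smooth, fun k => (h.bound k).mono hm⟩

theorem add (h : IsSymFam ρ m u) (h' : IsSymFam ρ m v) :
    IsSymFam ρ m (fun i z => u i z + v i z) :=
  ⟨fun i => (h.smooth i).add (h'.smooth i),
    fun k => SymBound.add h.smooth h'.smooth (h.bound k) (h'.bound k)⟩

theorem smul {a : ι → (Fin d → ℝ) → ℝ} (h : IsSymFam ρ m a) (h' : IsSymFam ρ m' u) :
    IsSymFam ρ (m + m') (fun i z => a i z • u i z) :=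
  ⟨fun i => (h.smooth i).smul (h'.smooth i),
    fun k => SymBound.smul h.smooth h'.smooth (h.bound k) (h'.bound k)⟩

theorem comp {κ : Type*} (h : IsSymFam ρ m u) (f : κ → ι) : IsSymFam ρ m (fun i => u (f i)) := by
  refine ⟨fun i => h.smooth (f i), fun k => ?_⟩
  have hb := h.bound k
  clear h
  induction k generalizing m u with
  | zero => exact hb.imp fun C hC i => hC (f i)
  | succ k ih => exact ⟨hb.1.imp fun C hC i => hC (f i), fun j => ih (hb.2 j)⟩

theorem pder (h : IsSymFam ρ m u) (j : Fin d) : IsSymFam ρ (m - ρ) (fun i => pder j (u i)) :=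
  ⟨fun i => contDiff_pder (h.smooth i) j, fun k => (h.bound (k + 1)).2 j⟩

theorem pder_iterate (h : IsSymFam ρ m u) (j : Fin d) (a : ℕ) :
    IsSymFam ρ (m - ρ * a) (fun i => (_root_.pder j)^[a] (u i)) := by
  induction a with
  | zero => simpa using h
  | succ a ih =>
    simp only [Function.iterate_succ_apply']
    exact (ih.pder j).mono (by push_cast; linarith)

theorem mder (h : IsSymFam ρ m u) (μ : Fin d → ℕ) :
    IsSymFam ρ (m - ρ * mOrder μ) (fun i => mder μ (u i)) := by
  have key : ∀ l : List (Fin d), IsSymFam ρ (m - ρ * ((l.map μ).sum : ℕ))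
      (fun i => l.foldr (fun i g => (_root_.pder i)^[μ i] g) (u i)) := by
    intro l
    induction l with
    | nil => simpa using h
    | cons i l ih =>
      exact (ih.pder_iterate i (μ i)).mono (by simp; linarith)
  have := key (List.finRange d)
  rwa [← List.ofFn_eq_map, List.sum_ofFn] at this

theorem zero : IsSymFam ρ m (fun (_ : ι) (_ : Fin d → ℝ) => (0 : V)) := by
  refine ⟨fun _ => contDiff_const, fun k => ?_⟩
  induction k generalizing m with
  | zero => exact ⟨0, by simp⟩
  | succ k ih =>
    refine ⟨⟨0, by simp⟩, fun j => ?_⟩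
    simp only [pder_const]
    exact ih

theorem const (c : V) : IsSymFam ρ 0 (fun (_ : ι) (_ : Fin d → ℝ) => c) := by
  refine ⟨fun _ => contDiff_const, fun k => ?_⟩
  cases k with
  | zero => exact ⟨‖c‖, by simp⟩
  | succ k =>
    refine ⟨⟨‖c‖, by simp⟩, fun j => ?_⟩
    simp only [pder_const]
    exact zero.bound k

theorem const_smul {𝕜 : Type*} [NormedField 𝕜] [NormedSpace 𝕜 V] [SMulCommClass ℝ 𝕜 V]
    (h : IsSymFam ρ m u) (c : 𝕜) : IsSymFam ρ m (fun i z => c • u i z) := by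
  refine ⟨fun i => (h.smooth i).const_smul c, fun k => ?_⟩
  have hb := h.bound k
  have hs := h.smooth
  clear h
  induction k generalizing m u with
  | zero => exact GrowthBound.const_smul hb c
  | succ k ih =>
    refine ⟨hb.1.const_smul c, fun j => ?_⟩
    simp only [pder_const_smul (hs _).differentiable_top]
    exact ih (hb.2 j) fun i => contDiff_pder (hs i) j

theorem clm (hρ : ρ ≤ 1) (L : (Fin d → ℝ) →L[ℝ] V) : IsSymFam ρ 1 (fun (_ : ι) z => L z) := by
  have base : GrowthBound 1 (fun (_ : ι) z => L z) := by
    refine ⟨‖L‖, fun _ z => (L.le_opNorm z).trans ?_⟩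
    gcongr
    rw [← Real.sqrt_eq_rpow]
    exact Real.le_sqrt_of_sq_le (by linarith)
  refine ⟨fun _ => L.contDiff, fun k => ?_⟩
  cases k with
  | zero => exact base
  | succ k =>
    refine ⟨base, fun j => ?_⟩
    simp only [pder_clm]
    exact ((const _).bound k).mono (by linarith)

end IsSymFam

theorem norm_le_iff_symWt_mul_le {μ : Fin d → ℕ} {x : Fin d → ℝ} {a C : ℝ} :
    symWt m ρ μ x * a ≤ C ↔ a ≤ C * (1 + ‖x‖ ^ 2) ^ ((m - ρ * mOrder μ) / 2) := by
  have hz : 0 < 1 + ‖x‖ ^ 2 := by positivity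
  rw [symWt, neg_div, Real.rpow_neg hz.le, inv_mul_le_iff₀ (Real.rpow_pos_of_pos hz _), mul_comm C]

theorem isSymbol_iff_isSymFam {F : (Fin d → ℝ) → V} :
    IsSymbol m ρ F ↔ IsSymFam ρ m (fun _ : Unit => F) := by
  constructor
  · rintro ⟨hF, hb⟩
    have base : ∀ μ : Fin d → ℕ, GrowthBound (m - ρ * mOrder μ) (fun _ : Unit => mder μ F) := by
      intro μ
      obtain ⟨C, hC⟩ := hb μ
      exact ⟨C, fun _ z => norm_le_iff_symWt_mul_le.1 (hC z)⟩
    have key : ∀ (k : ℕ) (μ : Fin d → ℕ),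
        SymBound ρ k (m - ρ * mOrder μ) (fun _ : Unit => mder μ F) := by
      intro k
      induction k with
      | zero => exact base
      | succ k ih =>
        refine fun μ => ⟨base μ, fun j => ?_⟩
        simp only [← mder_add_single hF]
        refine (ih (μ + Pi.single j 1)).mono (le_of_eq ?_)
        simp [mOrder, Finset.sum_add_distrib]
        ring
    have hz : ∀ l : List (Fin d),
        l.foldr (fun i g => (pder i)^[(0 : Fin d → ℕ) i] g) F = F := by
      intro l
      induction l with
      | nil => rfl
      | cons i l ih => simp
    refine ⟨fun _ => hF, fun k => ?_⟩
    have := key k 0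
    simpa [mOrder, mder, hz] using this
  · intro h
    refine ⟨h.smooth (), fun μ => ?_⟩
    obtain ⟨C, hC⟩ := (h.mder μ).bound 0
    exact ⟨C, fun x => norm_le_iff_symWt_mul_le.2 (hC () x)⟩

end SymbolFamilies

section SymbolOperations

variable {ι κ : Type*} {d : ℕ} {V : Type*} [NormedAddCommGroup V] [NormedSpace ℝ V]
  {ρ m : ℝ}

theorem IsSymFam.sum (s : Finset κ) {u : κ → ι → (Fin d → ℝ) → V}
    (h : ∀ c ∈ s, IsSymFam ρ m (u c)) : IsSymFam ρ m (fun i z => ∑ c ∈ s, u c i z) := by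
  classical
  induction s using Finset.induction_on with
  | empty => simpa using IsSymFam.zero
  | insert c s hc ih =>
    simp only [Finset.sum_insert hc]
    exact (h c (Finset.mem_insert_self c s)).add
      (ih fun b hb => h b (Finset.mem_insert_of_mem hb))

theorem IsSymFam.prod (s : Finset κ) {a : κ → ι → (Fin d → ℝ) → ℝ} {m : κ → ℝ}
    (h : ∀ c ∈ s, IsSymFam ρ (m c) (a c)) :
    IsSymFam ρ (∑ c ∈ s, m c) (fun i z => ∏ c ∈ s, a c i z) := by
  classical
  induction s using Finset.induction_on with
  | empty => simpa using IsSymFam.const (1 : ℝ)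
  | insert c s hc ih =>
    simp only [Finset.prod_insert hc, Finset.sum_insert hc]
    exact (h c (Finset.mem_insert_self c s)).smul
      (ih fun b hb => h b (Finset.mem_insert_of_mem hb))

theorem IsSymFam.pow {a : ι → (Fin d → ℝ) → ℝ} (h : IsSymFam ρ m a) (k : ℕ) :
    IsSymFam ρ (k * m) (fun i z => a i z ^ k) := by
  simpa using IsSymFam.prod (Finset.range k) (a := fun _ => a) fun _ _ => h

theorem pder_inv {q : (Fin d → ℝ) → ℝ} (hq : Differentiable ℝ q) (h0 : ∀ z, q z ≠ 0)
    (j : Fin d) : pder j (fun z => (q z)⁻¹) =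
      fun z => ((q z)⁻¹ • (q z)⁻¹) • ((-1 : ℝ) • pder j q z) := by
  funext z
  have h := ((hasDerivAt_inv (h0 z)).comp_hasFDerivAt z (hq z).hasFDerivAt).fderiv
  simp only [Function.comp_def] at h
  simp [pder, h, sq]

theorem IsSymFam.inv {q : ι → (Fin d → ℝ) → ℝ} (h : IsSymFam ρ m q) {c : ℝ} (hc : 0 < c)
    (hq : ∀ i z, c * (1 + ‖z‖ ^ 2) ^ (m / 2) ≤ q i z) :
    IsSymFam ρ (-m) (fun i z => (q i z)⁻¹) := by
  have hpos : ∀ i z, 0 < q i z := fun i z => lt_of_lt_of_le (by positivity) (hq i z)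
  have hs : ∀ i, ContDiff ℝ (⊤ : ℕ∞) fun z => (q i z)⁻¹ :=
    fun i => (h.smooth i).inv fun z => (hpos i z).ne'
  have base : GrowthBound (-m) (fun i z => (q i z)⁻¹) := by
    refine ⟨c⁻¹, fun i z => ?_⟩
    have hz : 0 < 1 + ‖z‖ ^ 2 := by positivity
    rw [Real.norm_of_nonneg (inv_nonneg.2 (hpos i z).le), neg_div, Real.rpow_neg hz.le, ← mul_inv]
    exact inv_anti₀ (by positivity) (hq i z)
  refine ⟨hs, fun k => ?_⟩
  induction k with
  | zero => exact base
  | succ k ih =>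
    refine ⟨base, fun j => ?_⟩
    simp only [pder_inv (h.smooth _).differentiable_top fun z => (hpos _ z).ne']
    exact (SymBound.smul (fun i => (hs i).smul (hs i))
      (fun i => (contDiff_pder (h.smooth i) j).const_smul _) (SymBound.smul hs hs ih ih)
      (((h.pder j).const_smul (-1 : ℝ)).bound k)).mono (by linarith)

theorem growthBound_cutoff {χ : (Fin d → ℝ) → ℝ} (hχ : Continuous χ) (hc : HasCompactSupport χ)
    (z₀ : Fin d → ℝ) (r : ℕ) :
    GrowthBound (-r) (fun (ε : Set.Ioc (0 : ℝ) 1) z => (ε : ℝ) ^ r • χ ((ε : ℝ) • (z - z₀))) := by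
  obtain ⟨B, hB⟩ := hχ.bounded_above_of_compact_support hc
  obtain ⟨R, hR⟩ := hc.isCompact.isBounded.exists_norm_le
  set S := R + ‖z₀‖ with hS
  refine ⟨(1 + S ^ 2) ^ ((r : ℝ) / 2) * B, ?_⟩
  rintro ⟨ε, hε0, hε1⟩ z
  have hz : 0 < 1 + ‖z‖ ^ 2 := by positivity
  have hB0 : 0 ≤ B := (norm_nonneg _).trans (hB 0)
  by_cases h0 : χ (ε • (z - z₀)) = 0
  · simp only [h0, smul_zero, norm_zero]
    positivity
  have h1 : ‖ε • (z - z₀)‖ ≤ R := hR _ (subset_tsupport _ h0)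
  have h2 : ε * ‖z‖ ≤ S := by
    rw [norm_smul, Real.norm_of_nonneg hε0.le] at h1
    have h3 : ‖z‖ ≤ ‖z - z₀‖ + ‖z₀‖ := by simpa using norm_add_le (z - z₀) z₀
    nlinarith [norm_nonneg z₀]
  have h3 : ε ^ 2 * (1 + ‖z‖ ^ 2) ≤ 1 + S ^ 2 := by
    have : (ε * ‖z‖) ^ 2 ≤ S ^ 2 := by gcongr
    nlinarith
  have h4 : ε ^ r * (1 + ‖z‖ ^ 2) ^ ((r : ℝ) / 2) ≤ (1 + S ^ 2) ^ ((r : ℝ) / 2) := by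
    have : ε ^ r = (ε ^ 2) ^ ((r : ℝ) / 2) := by
      rw [← Real.rpow_natCast ε 2, ← Real.rpow_mul hε0.le, ← Real.rpow_natCast]
      congr 1
      push_cast
      ring
    rw [this, ← Real.mul_rpow (by positivity) hz.le]
    gcongr
  rw [norm_smul, norm_pow, Real.norm_of_nonneg hε0.le, neg_div, Real.rpow_neg hz.le,
    mul_right_comm]
  gcongr
  · rwa [← div_eq_mul_inv, le_div_iff₀ (by positivity)]
  · exact hB _

theorem isSymFam_cutoff (hρ : ρ ≤ 1) {χ : (Fin d → ℝ) → ℝ} (hχ : ContDiff ℝ (⊤ : ℕ∞) χ)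
    (hc : HasCompactSupport χ) (z₀ : Fin d → ℝ) :
    IsSymFam ρ 0 (fun (ε : Set.Ioc (0 : ℝ) 1) z => χ ((ε : ℝ) • (z - z₀))) := by
  refine ⟨fun ε => hχ.comp (by fun_prop), fun k => ?_⟩
  suffices key : ∀ r : ℕ, SymBound ρ k (-r)
      (fun (ε : Set.Ioc (0 : ℝ) 1) z => (ε : ℝ) ^ r • χ ((ε : ℝ) • (z - z₀))) by
    simpa using key 0
  induction k generalizing χ with
  | zero => exact growthBound_cutoff hχ.continuous hc z₀
  | succ k ih =>
    refine fun r => ⟨growthBound_cutoff hχ.continuous hc z₀ r, fun j => ?_⟩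
    have h := ih (contDiff_pder hχ j) (hasCompactSupport_pder hc j) (r + 1)
    refine SymBound.mono ?_ (show -((r + 1 : ℕ) : ℝ) ≤ -r - ρ by push_cast; linarith)
    convert h using 3 with ε
    have hd : Differentiable ℝ fun z => χ ((ε : ℝ) • (z - z₀)) :=
      hχ.differentiable_top.comp (by fun_prop)
    rw [pder_const_smul hd, pder_comp_smul_sub hχ.differentiable_top, pow_succ, mul_smul]

end SymbolOperations

section Phase

variable {n : ℕ}

/-- The partial derivatives of the pairing `(p, x) ↦ ⟨p, x⟩`. -/
noncomputable def phaseGrad (M : Matrix (Fin n) (Fin n) ℝ) (j : Fin (n + n)) :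
    (Fin (n + n) → ℝ) →L[ℝ] ℝ :=
  LinearMap.toContinuousLinearMap
    { toFun := fun z =>
        (Fin.append (M.mulVec (sndHalf z)) (M.transpose.mulVec (fstHalf z)) : Fin (n + n) → ℝ) j
      map_add' := by
        intro z w
        have h1 : sndHalf (z + w) = sndHalf z + sndHalf w := rfl
        have h2 : fstHalf (z + w) = fstHalf z + fstHalf w := rfl
        rw [h1, h2, Matrix.mulVec_add, Matrix.mulVec_add]
        refine Fin.addCases (fun i => ?_) (fun i => ?_) j <;> simp [-Fin.natAdd_eq_addNat]
      map_smul' := by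
        intro c z
        have h1 : sndHalf (c • z) = c • sndHalf z := rfl
        have h2 : fstHalf (c • z) = c • fstHalf z := rfl
        rw [h1, h2, Matrix.mulVec_smul, Matrix.mulVec_smul]
        refine Fin.addCases (fun i => ?_) (fun i => ?_) j <;> simp [-Fin.natAdd_eq_addNat] }

variable (M : Matrix (Fin n) (Fin n) ℝ)

theorem phaseGrad_castAdd (k : Fin n) (z : Fin (n + n) → ℝ) :
    phaseGrad M (Fin.castAdd n k) z = M.mulVec (sndHalf z) k := by
  simp [phaseGrad]

theorem phaseGrad_natAdd (k : Fin n) (z : Fin (n + n) → ℝ) :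
    phaseGrad M (Fin.natAdd n k) z = M.transpose.mulVec (fstHalf z) k := by
  simp [phaseGrad, -Fin.natAdd_eq_addNat]

theorem fstHalf_single_castAdd (k : Fin n) :
    fstHalf (Pi.single (Fin.castAdd n k) (1 : ℝ)) = Pi.single k 1 := by
  funext i
  simp [fstHalf, Pi.single_apply, Fin.ext_iff]

theorem sndHalf_single_natAdd (k : Fin n) :
    sndHalf (Pi.single (Fin.natAdd n k) (1 : ℝ)) = Pi.single k 1 := by
  funext i
  simp [sndHalf, Pi.single_apply, Fin.ext_iff]

theorem sndHalf_single_castAdd (k : Fin n) :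
    sndHalf (Pi.single (Fin.castAdd n k) (1 : ℝ)) = 0 := by
  funext i
  have : (i : ℕ) + n ≠ k := by omega
  simp [sndHalf, Fin.ext_iff, this]

theorem fstHalf_single_natAdd (k : Fin n) :
    fstHalf (Pi.single (Fin.natAdd n k) (1 : ℝ)) = 0 := by
  funext i
  have : (i : ℕ) ≠ k + n := by omega
  simp [fstHalf, Fin.ext_iff, this]

theorem pairM_add_smul_single (z : Fin (n + n) → ℝ) (j : Fin (n + n)) (t : ℝ) :
    pairM M (fstHalf (z + t • Pi.single j 1)) (sndHalf (z + t • Pi.single j 1)) =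
      pairM M (fstHalf z) (sndHalf z) + t * phaseGrad M j z := by
  have h1 : ∀ v, sndHalf (z + t • v) = sndHalf z + t • sndHalf v := fun _ => rfl
  have h2 : ∀ v, fstHalf (z + t • v) = fstHalf z + t • fstHalf v := fun _ => rfl
  have hp : ∀ p x : Fin n → ℝ, pairM M p x = p ⬝ᵥ M.mulVec x := fun _ _ => rfl
  rw [h1, h2, hp, hp]
  refine Fin.addCases (fun k => ?_) (fun k => ?_) j
  · rw [fstHalf_single_castAdd, sndHalf_single_castAdd, phaseGrad_castAdd]
    simp [add_dotProduct]
  · rw [fstHalf_single_natAdd, sndHalf_single_natAdd, phaseGrad_natAdd]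
    simp only [smul_zero, add_zero, Matrix.mulVec_add, Matrix.mulVec_smul, dotProduct_add,
      dotProduct_smul, Matrix.mulVec_single_one, smul_eq_mul]
    rw [dotProduct_comm _ (M.col k)]
    rfl

theorem contDiff_phase : ContDiff ℝ (⊤ : ℕ∞) (phase M) := by
  refine ContDiff.cexp (contDiff_const.mul (Complex.ofRealCLM.contDiff.comp ?_))
  change ContDiff ℝ (⊤ : ℕ∞) fun z : Fin (n + n) → ℝ =>
    ∑ i, z (Fin.castAdd n i) * ∑ j, M i j * z (Fin.natAdd n j)
  exact ContDiff.sum fun i _ => (contDiff_apply ℝ ℝ (Fin.castAdd n i)).mul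
    (ContDiff.sum fun j _ => contDiff_const.mul (contDiff_apply ℝ ℝ (Fin.natAdd n j)))

theorem norm_phase (z : Fin (n + n) → ℝ) : ‖phase M z‖ = 1 := by
  rw [phase, mul_comm]
  exact Complex.norm_exp_ofReal_mul_I _

theorem pder_phase (j : Fin (n + n)) (z : Fin (n + n) → ℝ) :
    pder j (phase M) z = Complex.I * phaseGrad M j z * phase M z := by
  have h := ((contDiff_phase M).differentiable (by simp) z).hasFDerivAt.hasLineDerivAt
    (Pi.single j (1 : ℝ))
  refine HasLineDerivAt.unique h ?_
  change HasDerivAt (fun t : ℝ => Complex.exp (Complex.I *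
    (pairM M (fstHalf (z + t • Pi.single j 1)) (sndHalf (z + t • Pi.single j 1)) : ℂ))) _ 0
  simp only [pairM_add_smul_single]
  have h1 : HasDerivAt (fun t : ℝ => Complex.I *
      ((pairM M (fstHalf z) (sndHalf z) + t * phaseGrad M j z : ℝ) : ℂ))
      (Complex.I * ((1 * phaseGrad M j z : ℝ) : ℂ)) 0 :=
    (HasDerivAt.ofReal_comp (((hasDerivAt_id (0 : ℝ)).mul_const _).const_add _)).const_mul _
  convert h1.cexp using 1
  simp [phase]
  ring

theorem exists_norm_sq_le_phaseGrad (hM : |M.det| = 1) :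
    ∃ c : ℝ, 0 < c ∧ ∀ z : Fin (n + n) → ℝ,
      c * (1 + ‖z‖ ^ 2) ≤ 1 + ∑ j, phaseGrad M j z ^ 2 := by
  have hu : IsUnit M.det := isUnit_iff_ne_zero.2 fun h => by simp [h] at hM
  let L : (Fin (n + n) → ℝ) →ₗ[ℝ] (Fin (n + n) → ℝ) :=
    LinearMap.pi fun j => (phaseGrad M j : (Fin (n + n) → ℝ) →ₗ[ℝ] ℝ)
  have hL : LinearMap.ker L = ⊥ := by
    refine LinearMap.ker_eq_bot'.2 fun z hz => ?_
    have h1 : M.mulVec (sndHalf z) = 0 := by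
      funext k
      rw [← phaseGrad_castAdd]
      exact congrFun hz _
    have h2 : M.transpose.mulVec (fstHalf z) = 0 := by
      funext k
      rw [← phaseGrad_natAdd]
      exact congrFun hz _
    have h3 := Matrix.eq_zero_of_mulVec_eq_zero hu.ne_zero h1
    have h4 := Matrix.eq_zero_of_mulVec_eq_zero (by simpa using hu.ne_zero) h2
    funext j
    refine Fin.addCases (fun k => ?_) (fun k => ?_) j
    · exact congrFun h4 k
    · exact congrFun h3 k
  obtain ⟨K, hK, hKL⟩ := L.exists_antilipschitzWith hL
  have hK0 : (0 : ℝ) < K := hK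
  refine ⟨(1 + (K : ℝ) ^ 2)⁻¹, by positivity, fun z => ?_⟩
  have h1 : ‖z‖ ≤ K * ‖L z‖ := by
    simpa using hKL.le_mul_dist z 0
  have h2 : ‖L z‖ ^ 2 ≤ ∑ j, phaseGrad M j z ^ 2 := by
    have h0 : 0 ≤ ∑ j, phaseGrad M j z ^ 2 := Finset.sum_nonneg fun j _ => sq_nonneg _
    refine (Real.le_sqrt (norm_nonneg _) h0).1 ((pi_norm_le_iff_of_nonneg (by positivity)).2 ?_)
    intro j
    rw [Real.norm_eq_abs]
    refine Real.abs_le_sqrt ?_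
    exact Finset.single_le_sum (f := fun j => phaseGrad M j z ^ 2) (fun i _ => sq_nonneg _)
      (Finset.mem_univ j)
  rw [inv_mul_le_iff₀ (by positivity)]
  have h3 : ‖z‖ ^ 2 ≤ (K : ℝ) ^ 2 * ‖L z‖ ^ 2 := by
    rw [← mul_pow]
    gcongr
  nlinarith [sq_nonneg (K : ℝ), sq_nonneg ‖L z‖]

/-- The reciprocal of one plus the squared length of the gradient of the pairing. -/
noncomputable def phaseWt (z : Fin (n + n) → ℝ) : ℝ := (1 + ∑ j, phaseGrad M j z ^ 2)⁻¹

theorem isSymFam_phaseWt {ι : Type*} {ρ : ℝ} (hρ : ρ ≤ 1) (hM : |M.det| = 1) :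
    IsSymFam ρ (-2) (fun _ : ι => phaseWt M) := by
  obtain ⟨c, hc, h⟩ := exists_norm_sq_le_phaseGrad M hM
  refine IsSymFam.inv (m := 2) (q := fun (_ : ι) z => 1 + ∑ j, phaseGrad M j z ^ 2) ?_ hc
    fun _ z => by simpa using h z
  refine ((IsSymFam.const (1 : ℝ)).mono (by norm_num)).add (IsSymFam.sum _ fun j _ => ?_)
  simpa using (IsSymFam.clm hρ (phaseGrad M j)).pow 2

end Phase

section IntegrationByParts

variable {n : ℕ} {V : Type*} [NormedAddCommGroup V] [NormedSpace ℂ V]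
  (M : Matrix (Fin n) (Fin n) ℝ)

theorem integrable_phase_smul {u : (Fin (n + n) → ℝ) → V} (hu : Continuous u)
    (hc : HasCompactSupport u) : Integrable fun z => phase M z • u z :=
  ((contDiff_phase M).continuous.smul hu).integrable_of_hasCompactSupport hc.smul_left

variable [NormedSpace ℝ V]

/-- The operator obtained by one integration by parts against the phase. It leaves the
oscillatory integral unchanged and lowers the order of symbols. -/
noncomputable def ibpOp (u : (Fin (n + n) → ℝ) → V) (z : Fin (n + n) → ℝ) : V :=
  phaseWt M z • u z +
    Complex.I • ∑ j, pder j (fun y => phaseGrad M j y • phaseWt M y • u y) z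

variable {M} in
theorem HasCompactSupport.ibpOp {u : (Fin (n + n) → ℝ) → V} (hc : HasCompactSupport u) :
    HasCompactSupport (ibpOp M u) := by
  refine HasCompactSupport.add hc.smul_left (HasCompactSupport.smul_left ?_)
  have h : ∀ s : Finset (Fin (n + n)), HasCompactSupport fun z =>
      ∑ j ∈ s, pder j (fun y => phaseGrad M j y • phaseWt M y • u y) z := by
    intro s
    induction s using Finset.induction_on with
    | empty =>
      simp only [Finset.sum_empty]
      exact HasCompactSupport.zero
    | insert j s hj ih =>
      simp only [Finset.sum_insert hj]
      exact (hasCompactSupport_pder (HasCompactSupport.smul_left hc.smul_left) j).add ih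
  exact h _

variable [IsScalarTower ℝ ℂ V]

theorem integral_phase_smul_pder {u : (Fin (n + n) → ℝ) → V} (hu : ContDiff ℝ (⊤ : ℕ∞) u)
    (hc : HasCompactSupport u) (j : Fin (n + n)) :
    ∫ z, phase M z • pder j u z = -∫ z, Complex.I • phase M z • phaseGrad M j z • u z := by
  have hpd : ∀ z, fderiv ℝ (phase M) z (Pi.single j 1) • u z =
      Complex.I • phase M z • phaseGrad M j z • u z := by
    intro z
    change pder j (phase M) z • u z = _
    have hcoe : ((phaseGrad M j z : ℝ) : ℂ) • u z = phaseGrad M j z • u z :=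
      algebraMap_smul ℂ (phaseGrad M j z) (u z)
    rw [pder_phase, mul_right_comm, mul_smul, mul_smul, hcoe]
  have h1 : Integrable fun z => Complex.I • phase M z • phaseGrad M j z • u z :=
    (integrable_phase_smul M ((phaseGrad M j).continuous.smul hu.continuous) hc.smul_left).smul
      Complex.I
  have h := integral_smul_fderiv_eq_neg_fderiv_smul_of_integrable (μ := volume)
    (f := phase M) (g := u) (v := Pi.single j 1)
    (by simpa only [hpd] using h1)
    (integrable_phase_smul M (contDiff_pder hu j).continuous (hasCompactSupport_pder hc j))
    (integrable_phase_smul M hu.continuous hc)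
    (fun z _ => (contDiff_phase M).differentiable (by simp) z)
    (fun z _ => hu.differentiable_top z)
  simp only [hpd] at h
  exact h

variable {M}

theorem IsSymFam.ibpOp {ι : Type*} {ρ m : ℝ} (hρ : ρ ≤ 1) (hM : |M.det| = 1)
    {u : ι → (Fin (n + n) → ℝ) → V} (h : IsSymFam ρ m u) :
    IsSymFam ρ (m - (1 + ρ)) (fun i => ibpOp M (u i)) := by
  have hw := (isSymFam_phaseWt M (ι := ι) hρ hM).smul h
  refine (hw.mono (by linarith)).add (IsSymFam.const_smul (IsSymFam.sum _ fun j _ => ?_) _)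
  exact (((IsSymFam.clm hρ (phaseGrad M j)).smul hw).pder j).mono (by linarith)

theorem integral_phase_smul_ibpOp (hM : |M.det| = 1) {u : (Fin (n + n) → ℝ) → V}
    (hu : ContDiff ℝ (⊤ : ℕ∞) u) (hc : HasCompactSupport u) :
    ∫ z, phase M z • ibpOp M u z = ∫ z, phase M z • u z := by
  have hw : ContDiff ℝ (⊤ : ℕ∞) (phaseWt M) :=
    (isSymFam_phaseWt M (ι := Unit) le_rfl hM).smooth ()
  have hwu : ContDiff ℝ (⊤ : ℕ∞) fun z => phaseWt M z • u z := hw.smul hu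
  have hwc : HasCompactSupport fun z => phaseWt M z • u z := hc.smul_left
  have hlu : ∀ j, ContDiff ℝ (⊤ : ℕ∞) fun z => phaseGrad M j z • phaseWt M z • u z :=
    fun j => (phaseGrad M j).contDiff.smul hwu
  have hlc : ∀ j, HasCompactSupport fun z => phaseGrad M j z • phaseWt M z • u z :=
    fun j => hwc.smul_left
  have hi1 := integrable_phase_smul M hwu.continuous hwc
  have hi2 : ∀ j, Integrable fun z =>
      phase M z • pder j (fun y => phaseGrad M j y • phaseWt M y • u y) z := fun j =>
    integrable_phase_smul M (contDiff_pder (hlu j) j).continuous (hasCompactSupport_pder (hlc j) j)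
  have hi3 : ∀ j, Integrable fun z =>
      phase M z • phaseGrad M j z • phaseGrad M j z • phaseWt M z • u z := fun j =>
    integrable_phase_smul M ((phaseGrad M j).continuous.smul (hlu j).continuous) (hlc j).smul_left
  have hi4 : Integrable fun z => Complex.I • ∑ j,
      phase M z • pder j (fun y => phaseGrad M j y • phaseWt M y • u y) z :=
    (integrable_finsetSum _ fun j _ => hi2 j).smul _
  have e1 : ∀ z, phase M z • ibpOp M u z = phase M z • phaseWt M z • u z +
      Complex.I • ∑ j, phase M z • pder j (fun y => phaseGrad M j y • phaseWt M y • u y) z := by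
    intro z
    rw [ibpOp, smul_add, smul_comm (phase M z) Complex.I, Finset.smul_sum]
  have e2 : ∀ z, phase M z • u z = phase M z • phaseWt M z • u z +
      ∑ j, phase M z • phaseGrad M j z • phaseGrad M j z • phaseWt M z • u z := by
    intro z
    have h0 : 0 < 1 + ∑ j, phaseGrad M j z ^ 2 := by positivity
    have h1 : phaseWt M z + ∑ j, phaseGrad M j z ^ 2 * phaseWt M z = 1 := by
      rw [← Finset.sum_mul, ← one_add_mul, phaseWt, mul_inv_cancel₀ h0.ne']
    simp only [smul_smul (phaseGrad M _ z), ← Finset.smul_sum, ← smul_add]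
    conv_lhs => rw [← one_smul ℝ (u z), ← h1]
    simp only [← mul_assoc, ← sq, ← Finset.sum_smul, ← add_smul]
  simp only [e1]
  rw [integral_add hi1 hi4, integral_smul, integral_finsetSum _ fun j _ => hi2 j]
  simp only [e2]
  rw [integral_add hi1 (integrable_finsetSum _ fun j _ => hi3 j),
    integral_finsetSum _ fun j _ => hi3 j, Finset.smul_sum]
  congr 1
  refine Finset.sum_congr rfl fun j _ => ?_
  rw [integral_phase_smul_pder M (hlu j) (hlc j), integral_smul, smul_neg, smul_smul,
    Complex.I_mul_I, neg_one_smul, neg_neg]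

/-- Oscillatory integrals of a bounded family of compactly supported symbols are bounded. -/
theorem exists_norm_integral_phase_smul_le {ι : Type*} {ρ m : ℝ} (hρ1 : -1 < ρ) (hρ2 : ρ ≤ 1)
    (hM : |M.det| = 1) {u : ι → (Fin (n + n) → ℝ) → V} (h : IsSymFam ρ m u)
    (hc : ∀ i, HasCompactSupport (u i)) : ∃ C : ℝ, ∀ i, ‖∫ z, phase M z • u i z‖ ≤ C := by
  have key : ∀ N : ℕ, IsSymFam ρ (m - N * (1 + ρ)) (fun i => (ibpOp M)^[N] (u i)) ∧
      (∀ i, HasCompactSupport ((ibpOp M)^[N] (u i))) ∧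
      ∀ i, ∫ z, phase M z • (ibpOp M)^[N] (u i) z = ∫ z, phase M z • u i z := by
    intro N
    induction N with
    | zero => simpa using ⟨h, hc⟩
    | succ N ih =>
      obtain ⟨h1, h2, h3⟩ := ih
      simp only [Function.iterate_succ_apply']
      refine ⟨(h1.ibpOp hρ2 hM).mono (by push_cast; linarith), fun i => (h2 i).ibpOp, fun i => ?_⟩
      rw [integral_phase_smul_ibpOp hM (h1.smooth i) (h2 i), h3]
  set r : ℝ := n + n + 1
  obtain ⟨N, hN⟩ := exists_nat_ge ((m + r) / (1 + ρ))
  have hN' : m - N * (1 + ρ) ≤ -r := by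
    rw [div_le_iff₀ (by linarith)] at hN
    linarith
  obtain ⟨h1, -, h3⟩ := key N
  obtain ⟨C, hC⟩ := (h1.bound 0).mono hN'
  refine ⟨∫ z : Fin (n + n) → ℝ, C * (1 + ‖z‖ ^ 2) ^ (-r / 2), fun i => ?_⟩
  rw [← h3]
  refine norm_integral_le_of_norm_le ((integrable_rpow_neg_one_add_norm_sq ?_).const_mul C) ?_
  · simp [r]
  · refine Eventually.of_forall fun z => ?_
    rw [norm_smul, norm_phase, one_mul]
    exact hC i z

end IntegrationByParts

section OscillatoryIntegrals

variable {n : ℕ} {V : Type*} [NormedAddCommGroup V] [NormedSpace ℝ V] [NormedSpace ℂ V]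
  [IsScalarTower ℝ ℂ V] {M : Matrix (Fin n) (Fin n) ℝ}

theorem hasCompactSupport_comp_smul_sub {d : ℕ} {χ : (Fin d → ℝ) → ℝ} (hc : HasCompactSupport χ)
    (z₀ : Fin d → ℝ) {ε : ℝ} (hε : ε ≠ 0) : HasCompactSupport fun z => χ (ε • (z - z₀)) :=
  hc.comp_homeomorph ((Homeomorph.subRight z₀).trans (Homeomorph.smulOfNeZero ε hε))

theorem cutInt_const_smul (χ : (Fin (n + n) → ℝ) → ℝ) (z₀ : Fin (n + n) → ℝ) (ε : ℝ) (c : ℂ)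
    (F : (Fin (n + n) → ℝ) → V) :
    cutInt M χ z₀ ε (fun z => c • F z) = c • cutInt M χ z₀ ε F := by
  unfold cutInt
  rw [smul_comm c, ← integral_smul c]
  congr 2
  funext z
  rw [smul_comm (phase M z) c, smul_comm _ c]

theorem cutInt_pder {χ : (Fin (n + n) → ℝ) → ℝ} (hχ : ContDiff ℝ (⊤ : ℕ∞) χ)
    (hc : HasCompactSupport χ) (z₀ : Fin (n + n) → ℝ) {ε : ℝ} (hε : ε ≠ 0)
    {G : (Fin (n + n) → ℝ) → V} (hG : ContDiff ℝ (⊤ : ℕ∞) G) (j : Fin (n + n)) :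
    cutInt M χ z₀ ε (pder j G) =
      (-Complex.I) • cutInt M χ z₀ ε (fun z => phaseGrad M j z • G z) -
        ε • cutInt M (pder j χ) z₀ ε G := by
  have hw : ContDiff ℝ (⊤ : ℕ∞) fun z => χ (ε • (z - z₀)) := hχ.comp (by fun_prop)
  have hwc := hasCompactSupport_comp_smul_sub hc z₀ hε
  have hw' : ContDiff ℝ (⊤ : ℕ∞) fun z => pder j χ (ε • (z - z₀)) :=
    (contDiff_pder hχ j).comp (by fun_prop)
  have hwc' := hasCompactSupport_comp_smul_sub (hasCompactSupport_pder hc j) z₀ hε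
  have h := integral_phase_smul_pder M (u := fun z => χ (ε • (z - z₀)) • G z) (hw.smul hG)
    hwc.smul_right j
  rw [pder_smul hw.differentiable_top hG.differentiable_top,
    pder_comp_smul_sub hχ.differentiable_top] at h
  have i1 := integrable_phase_smul M (u := fun z => pder j χ (ε • (z - z₀)) • G z)
    (hw'.smul hG).continuous hwc'.smul_right
  have i2 := integrable_phase_smul M (u := fun z => χ (ε • (z - z₀)) • pder j G z)
    (hw.smul (contDiff_pder hG j)).continuous hwc.smul_right
  simp only [smul_add, smul_assoc ε, smul_comm (phase M _) ε] at h
  have i3 : Integrable fun z => ε • phase M z • pder j χ (ε • (z - z₀)) • G z := i1.smul ε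
  rw [integral_add i3 i2, integral_smul, integral_smul] at h
  unfold cutInt
  rw [smul_comm (-Complex.I), smul_comm ε, ← smul_sub]
  congr 1
  simp only [smul_comm (χ _) (phase M _), smul_comm (pder j χ _) (phase M _),
    smul_comm (χ _) (phaseGrad M j _)]
  rw [neg_smul, ← h]
  abel

variable (M) in
/-- Two amplitudes are equivalent if the difference of their cut-off oscillatory integrals tends
to zero for every smooth compactly supported cut-off. -/
def OscEquiv (A B : (Fin (n + n) → ℝ) → V) : Prop :=
  ∀ χ : (Fin (n + n) → ℝ) → ℝ, ContDiff ℝ (⊤ : ℕ∞) χ → HasCompactSupport χ →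
    ∀ z₀ : Fin (n + n) → ℝ,
      Tendsto (fun ε : ℝ => cutInt M χ z₀ ε A - cutInt M χ z₀ ε B) (nhdsWithin 0 (Set.Ioi 0))
        (nhds 0)

theorem OscEquiv.refl (A : (Fin (n + n) → ℝ) → V) : OscEquiv M A A := by
  intro χ _ _ z₀
  simp

theorem OscEquiv.symm {A B : (Fin (n + n) → ℝ) → V} (h : OscEquiv M A B) : OscEquiv M B A := by
  intro χ hχ hc z₀
  simpa using (h χ hχ hc z₀).neg

theorem OscEquiv.trans {A B C : (Fin (n + n) → ℝ) → V} (h : OscEquiv M A B)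
    (h' : OscEquiv M B C) : OscEquiv M A C := by
  intro χ hχ hc z₀
  simpa using (h χ hχ hc z₀).add (h' χ hχ hc z₀)

theorem OscEquiv.const_smul {A B : (Fin (n + n) → ℝ) → V} (h : OscEquiv M A B) (c : ℂ) :
    OscEquiv M (fun z => c • A z) (fun z => c • B z) := by
  intro χ hχ hc z₀
  simpa [cutInt_const_smul, smul_sub] using (h χ hχ hc z₀).const_smul c

theorem oscEquiv_pder {ρ m : ℝ} (hρ1 : -1 < ρ) (hρ2 : ρ ≤ 1) (hM : |M.det| = 1)
    {G : (Fin (n + n) → ℝ) → V} (hG : IsSymbol m ρ G) (j : Fin (n + n)) :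
    OscEquiv M (pder j G) (fun z => (-Complex.I) • phaseGrad M j z • G z) := by
  intro χ hχ hc z₀
  have hχ' := contDiff_pder hχ j
  have hc' := hasCompactSupport_pder hc j
  have hfam : IsSymFam ρ m (fun _ : Set.Ioc (0 : ℝ) 1 => G) :=
    (isSymbol_iff_isSymFam.1 hG).comp fun _ => ()
  obtain ⟨C, hC⟩ := exists_norm_integral_phase_smul_le hρ1 hρ2 hM
    ((isSymFam_cutoff hρ2 hχ' hc' z₀).smul hfam)
    fun ε => (hasCompactSupport_comp_smul_sub hc' z₀ ε.2.1.ne').smul_right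
  have hlim : Tendsto (fun ε : ℝ => ε * (‖((2 * Real.pi) ^ n)⁻¹‖ * C))
      (nhdsWithin 0 (Set.Ioi 0)) (nhds 0) := by
    have : Tendsto (fun ε : ℝ => ε * (‖((2 * Real.pi) ^ n)⁻¹‖ * C)) (nhds 0) (nhds 0) := by
      simpa using (tendsto_id (α := ℝ) (x := nhds 0)).mul_const (‖((2 * Real.pi) ^ n)⁻¹‖ * C)
    exact this.mono_left nhdsWithin_le_nhds
  refine squeeze_zero_norm' ?_ hlim
  filter_upwards [Ioc_mem_nhdsGT (zero_lt_one' ℝ)] with ε hε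
  rw [cutInt_const_smul, cutInt_pder hχ hc z₀ hε.1.ne' hG.1, sub_sub_cancel_left, norm_neg,
    norm_smul, Real.norm_of_nonneg hε.1.le]
  unfold cutInt
  rw [norm_smul]
  have := hC ⟨ε, hε⟩
  simp only [smul_comm (phase M _)] at this
  gcongr
  exact hε.1.le

theorem foldr_pder_smul {d : ℕ} {W : Type*} [NormedAddCommGroup W] [NormedSpace ℝ W]
    {a : (Fin d → ℝ) → ℝ} (ha : ContDiff ℝ (⊤ : ℕ∞) a)
    {G : (Fin d → ℝ) → W} (hG : ContDiff ℝ (⊤ : ℕ∞) G) (L : List (Fin d))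
    (hL : ∀ j ∈ L, pder j a = fun _ => 0) :
    ContDiff ℝ (⊤ : ℕ∞) (L.foldr pder G) ∧
      L.foldr pder (fun z => a z • G z) = fun z => a z • L.foldr pder G z := by
  induction L with
  | nil => exact ⟨hG, rfl⟩
  | cons j L ih =>
    obtain ⟨h1, h2⟩ := ih fun i hi => hL i (List.mem_cons_of_mem _ hi)
    refine ⟨contDiff_pder h1 j, ?_⟩
    rw [List.foldr_cons, h2, pder_smul ha.differentiable_top h1.differentiable_top,
      hL j List.mem_cons_self]
    simp

theorem IsSymbol.foldr_pder {d : ℕ} {W : Type*} [NormedAddCommGroup W] [NormedSpace ℝ W]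
    {ρ m : ℝ} {G : (Fin d → ℝ) → W} (hG : IsSymbol m ρ G) (L : List (Fin d)) :
    IsSymbol (m - ρ * L.length) ρ (L.foldr pder G) := by
  rw [isSymbol_iff_isSymFam] at hG ⊢
  induction L with
  | nil => simpa using hG
  | cons j L ih => exact (ih.pder j).mono (by push_cast [List.length_cons]; linarith)

theorem oscEquiv_foldr_pder {ρ m : ℝ} (hρ1 : -1 < ρ) (hρ2 : ρ ≤ 1) (hM : |M.det| = 1)
    (L : List (Fin (n + n)))
    (hL : ∀ i ∈ L, ∀ j ∈ L, phaseGrad M i (Pi.single j 1) = 0)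
    {G : (Fin (n + n) → ℝ) → V} (hG : IsSymbol m ρ G) :
    OscEquiv M (L.foldr pder G) (fun z =>
      (-Complex.I) ^ L.length • (L.map fun j => phaseGrad M j z).prod • G z) := by
  induction L generalizing m G with
  | nil => simpa using OscEquiv.refl G
  | cons j L ih =>
    have hG' : IsSymbol (1 + m) ρ (fun z => phaseGrad M j z • G z) := by
      rw [isSymbol_iff_isSymFam] at hG ⊢
      exact (IsSymFam.clm hρ2 (phaseGrad M j)).smul hG
    have h0 : ∀ i ∈ L, pder i (fun z => phaseGrad M j z) = fun _ => 0 := by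
      intro i hi
      rw [pder_clm, hL j List.mem_cons_self i (List.mem_cons_of_mem _ hi)]
    have h1 := oscEquiv_pder hρ1 hρ2 hM (hG.foldr_pder L) j
    have h2 := (ih (fun i hi k hk => hL i (List.mem_cons_of_mem _ hi) k
      (List.mem_cons_of_mem _ hk)) hG').const_smul (-Complex.I)
    rw [(foldr_pder_smul (phaseGrad M j).contDiff hG.1 L h0).2] at h2
    change OscEquiv M (pder j (L.foldr pder G)) _
    convert h1.trans h2 using 1
    funext z
    rw [List.length_cons, pow_succ', List.map_cons, List.prod_cons, smul_smul, smul_smul,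
      mul_comm (phaseGrad M j z)]

theorem mder_eq_foldr_pder {d : ℕ} {W : Type*} [NormedAddCommGroup W] [NormedSpace ℝ W]
    (μ : Fin d → ℕ) (F : (Fin d → ℝ) → W) :
    mder μ F = ((List.finRange d).flatMap fun i => List.replicate (μ i) i).foldr pder F := by
  have h : ∀ (k : ℕ) (i : Fin d) (g : (Fin d → ℝ) → W),
      (List.replicate k i).foldr pder g = (pder i)^[k] g := by
    intro k i g
    induction k with
    | zero => rfl
    | succ k ih => rw [List.replicate_succ, List.foldr_cons, ih, Function.iterate_succ_apply']
  rw [List.foldr_flatMap]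
  simp only [h]
  rfl

theorem oscEquiv_mder {ρ m : ℝ} (hρ1 : -1 < ρ) (hρ2 : ρ ≤ 1) (hM : |M.det| = 1)
    {F : (Fin (n + n) → ℝ) → V} (hF : IsSymbol m ρ F) (ν : Fin (n + n) → ℕ)
    (hν : ∀ i j, ν i ≠ 0 → ν j ≠ 0 → phaseGrad M i (Pi.single j 1) = 0) :
    OscEquiv M (mder ν F) (fun z =>
      (-Complex.I) ^ mOrder ν • (∏ j, phaseGrad M j z ^ ν j) • F z) := by
  set L := (List.finRange (n + n)).flatMap fun i => List.replicate (ν i) i with hLdef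
  have hlen : L.length = mOrder ν := by
    rw [hLdef, List.length_flatMap, mOrder]
    simp [← List.ofFn_eq_map, List.sum_ofFn]
  have hprod : ∀ z, (L.map fun j => phaseGrad M j z).prod = ∏ j, phaseGrad M j z ^ ν j := by
    intro z
    have : ∀ l : List (Fin (n + n)), ((l.flatMap fun i => List.replicate (ν i) i).map
        fun j => phaseGrad M j z).prod = (l.map fun j => phaseGrad M j z ^ ν j).prod := by
      intro l
      induction l with
      | nil => rfl
      | cons i l ih => simp [ih]
    rw [hLdef, this, ← List.ofFn_eq_map, List.prod_ofFn]
  have hL : ∀ i ∈ L, ν i ≠ 0 := by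
    intro i hi
    simp only [hLdef, List.mem_flatMap, List.mem_replicate] at hi
    obtain ⟨k, -, hk, rfl⟩ := hi
    exact hk
  have h := oscEquiv_foldr_pder hρ1 hρ2 hM L (fun i hi j hj => hν i j (hL i hi) (hL j hj)) hF
  rw [mder_eq_foldr_pder]
  simpa only [hlen, hprod] using h

theorem IsOscInt.of_oscEquiv {A B : (Fin (n + n) → ℝ) → V} (h : OscEquiv M A B) {v : V}
    (hB : IsOscInt M B v) : IsOscInt M A v := by
  intro χ hχ hc h1 z₀
  simpa using (h χ hχ hc z₀).add (hB χ hχ hc h1 z₀)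

theorem IsOscInt.const_smul {A : (Fin (n + n) → ℝ) → V} {v : V} (hA : IsOscInt M A v) (c : ℂ) :
    IsOscInt M (fun z => c • A z) (c • v) := by
  intro χ hχ hc h1 z₀
  simpa only [cutInt_const_smul] using (hA χ hχ hc h1 z₀).const_smul c

theorem IsOscInt.unique {A : (Fin (n + n) → ℝ) → V} {v w : V} (hv : IsOscInt M A v)
    (hw : IsOscInt M A w) : v = w := by
  let f : ContDiffBump (0 : Fin (n + n) → ℝ) := ⟨1, 2, one_pos, one_lt_two⟩
  exact tendsto_nhds_unique (hv f f.contDiff f.hasCompactSupport f.eventuallyEq_one 0)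
    (hw f f.contDiff f.hasCompactSupport f.eventuallyEq_one 0)

theorem IsOscInt.oscInt_eq {A : (Fin (n + n) → ℝ) → V} {v : V} (hv : IsOscInt M A v) :
    oscInt M A = v := by
  have h : ∃ v, IsOscInt M A v := ⟨v, hv⟩
  rw [oscInt, dif_pos h]
  exact h.choose_spec.unique hv

theorem oscInt_eq_smul_of_oscEquiv {A B : (Fin (n + n) → ℝ) → V} {c : ℂ} (hc : c ≠ 0)
    (h : OscEquiv M A (fun z => c • B z)) : oscInt M A = c • oscInt M B := by
  by_cases hB : ∃ v, IsOscInt M B v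
  · obtain ⟨v, hv⟩ := hB
    rw [hv.oscInt_eq, ((hv.const_smul c).of_oscEquiv h).oscInt_eq]
  · have hA : ¬ ∃ v, IsOscInt M A v := by
      rintro ⟨v, hv⟩
      refine hB ⟨c⁻¹ • v, ?_⟩
      simpa [smul_smul, inv_mul_cancel₀ hc] using (hv.of_oscEquiv h.symm).const_smul c⁻¹
    rw [oscInt, oscInt, dif_neg hA, dif_neg hB, smul_zero]

theorem isSymbol_prod_phaseGrad_pow_smul {W : Type*} [NormedAddCommGroup W] [NormedSpace ℝ W]
    {ρ m : ℝ} (hρ : ρ ≤ 1) {F : (Fin (n + n) → ℝ) → W} (hF : IsSymbol m ρ F) (ν : Fin (n + n) → ℕ) :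
    IsSymbol (m + mOrder ν) ρ (fun z => (∏ j, phaseGrad M j z ^ ν j) • F z) := by
  rw [isSymbol_iff_isSymFam] at hF ⊢
  refine (IsSymFam.smul (IsSymFam.prod Finset.univ fun j _ =>
    (IsSymFam.clm hρ (phaseGrad M j)).pow (ν j)) hF).mono (le_of_eq ?_)
  simp [mOrder, add_comm]

theorem prod_phaseGrad_pow_append_zero (μ : Fin n → ℕ) (z : Fin (n + n) → ℝ) :
    ∏ j, phaseGrad M j z ^ (Fin.append μ (0 : Fin n → ℕ) : Fin (n + n) → ℕ) j =
      ∏ k, M.mulVec (sndHalf z) k ^ μ k := by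
  simp [Fin.prod_univ_add, phaseGrad_castAdd, -Fin.natAdd_eq_addNat]

theorem prod_phaseGrad_pow_zero_append (μ : Fin n → ℕ) (z : Fin (n + n) → ℝ) :
    ∏ j, phaseGrad M j z ^ (Fin.append (0 : Fin n → ℕ) μ : Fin (n + n) → ℕ) j =
      ∏ k, M.transpose.mulVec (fstHalf z) k ^ μ k := by
  simp [Fin.prod_univ_add, phaseGrad_natAdd, -Fin.natAdd_eq_addNat]

theorem mOrder_append (μ ν : Fin n → ℕ) :
    mOrder (Fin.append μ ν : Fin (n + n) → ℕ) = mOrder μ + mOrder ν := by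
  simp [mOrder, Fin.sum_univ_add, -Fin.natAdd_eq_addNat]

theorem mOrder_zero : mOrder (0 : Fin n → ℕ) = 0 := by
  simp [mOrder]

theorem IsSymbol.mder {d : ℕ} {W : Type*} [NormedAddCommGroup W] [NormedSpace ℝ W]
    {ρ m : ℝ} {F : (Fin d → ℝ) → W} (hF : IsSymbol m ρ F) (ν : Fin d → ℕ) :
    IsSymbol (m - ρ * mOrder ν) ρ (mder ν F) :=
  isSymbol_iff_isSymFam.2 ((isSymbol_iff_isSymFam.1 hF).mder ν)

end OscillatoryIntegrals

theorem statement14 {n : ℕ} {V : Type*} [NormedAddCommGroup V] [NormedSpace ℝ V]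
    [NormedSpace ℂ V] [IsScalarTower ℝ ℂ V] [CompleteSpace V]
    (M : Matrix (Fin n) (Fin n) ℝ) (hM : |M.det| = 1)
    (m ρ : ℝ) (hρ1 : -1 < ρ) (hρ2 : ρ ≤ 1)
    (F : (Fin (n + n) → ℝ) → V) (hF : IsSymbol m ρ F) (μ : Fin n → ℕ) :
    IsSymbol (m - ρ * (mOrder μ : ℝ)) ρ (mder (Fin.append μ (0 : Fin n → ℕ)) F) ∧
    IsSymbol (m - ρ * (mOrder μ : ℝ)) ρ (mder (Fin.append (0 : Fin n → ℕ) μ) F) ∧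
    IsSymbol (m + (mOrder μ : ℝ)) ρ
      (fun z : Fin (n + n) → ℝ => (∏ k : Fin n, M.mulVec (sndHalf z) k ^ μ k) • F z) ∧
    IsSymbol (m + (mOrder μ : ℝ)) ρ
      (fun z : Fin (n + n) → ℝ => (∏ k : Fin n, M.transpose.mulVec (fstHalf z) k ^ μ k) • F z) ∧
    oscInt M (mder (Fin.append μ (0 : Fin n → ℕ)) F) =
      (-Complex.I) ^ (mOrder μ) •
        oscInt M (fun z : Fin (n + n) → ℝ =>
          (∏ k : Fin n, M.mulVec (sndHalf z) k ^ μ k) • F z) ∧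
    oscInt M (mder (Fin.append (0 : Fin n → ℕ) μ) F) =
      (-Complex.I) ^ (mOrder μ) •
        oscInt M (fun z : Fin (n + n) → ℝ =>
          (∏ k : Fin n, M.transpose.mulVec (fstHalf z) k ^ μ k) • F z) := by
  have hl : mOrder (Fin.append μ (0 : Fin n → ℕ) : Fin (n + n) → ℕ) = mOrder μ := by
    rw [mOrder_append, mOrder_zero, add_zero]
  have hr : mOrder (Fin.append (0 : Fin n → ℕ) μ : Fin (n + n) → ℕ) = mOrder μ := by
    rw [mOrder_append, mOrder_zero, zero_add]
  have hI : (-Complex.I) ^ mOrder μ ≠ 0 := pow_ne_zero _ (neg_ne_zero.2 Complex.I_ne_zero)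
  refine ⟨?_, ?_, ?_, ?_, oscInt_eq_smul_of_oscEquiv hI ?_, oscInt_eq_smul_of_oscEquiv hI ?_⟩
  · simpa only [hl] using hF.mder (Fin.append μ (0 : Fin n → ℕ))
  · simpa only [hr] using hF.mder (Fin.append (0 : Fin n → ℕ) μ)
  · simpa only [hl, prod_phaseGrad_pow_append_zero] using
      isSymbol_prod_phaseGrad_pow_smul (M := M) hρ2 hF (Fin.append μ (0 : Fin n → ℕ))
  · simpa only [hr, prod_phaseGrad_pow_zero_append] using
      isSymbol_prod_phaseGrad_pow_smul (M := M) hρ2 hF (Fin.append (0 : Fin n → ℕ) μ)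
  · have h := oscEquiv_mder hρ1 hρ2 hM hF (Fin.append μ (0 : Fin n → ℕ)) fun i j => by
      refine Fin.addCases (fun k => ?_) (fun k => ?_) j <;>
        refine Fin.addCases (fun l => ?_) (fun l => ?_) i <;>
        simp [phaseGrad_castAdd, sndHalf_single_castAdd, -Fin.natAdd_eq_addNat]
    simpa only [hl, prod_phaseGrad_pow_append_zero] using h
  · have h := oscEquiv_mder hρ1 hρ2 hM hF (Fin.append (0 : Fin n → ℕ) μ) fun i j => by
      refine Fin.addCases (fun k => ?_) (fun k => ?_) j <;>
        refine Fin.addCases (fun l => ?_) (fun l => ?_) i <;>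
        simp [phaseGrad_natAdd, fstHalf_single_natAdd, -Fin.natAdd_eq_addNat]
    simpa only [hr, prod_phaseGrad_pow_zero_append] using h
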